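/- arXiv:1809.01779 — 12 statements merged into one kernel-verified Lean document; each statement's English description precedes it below -/
import Mathlib

section
/- Let p and q be integers greater than 1 with gcd(p,q) = 1, with q odd, and with p > q whenever p is also odd. Then (p − 2t)(q − 2h) ≥ 0, and equality holds if and only if p = 2; moreover, when p = 2 one has p − 2t = 0 and q − 2h = −1. -/
/-- For relatively prime integers `p, q > 1` with `q` odd and `p > q` whenever `p` is odd,
and `t, h` the unique integers with `p*h - q*t = 1`, `1 ≤ h ≤ q - 1`, one has
`(p - 2t)(q - 2h) ≥ 0`, with equality iff `p = 2`; and when `p = 2`,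
`p - 2t = 0` and `q - 2h = -1`. -/
theorem stmt_1 (p q t h : ℤ) (hp : 1 < p) (hq : 1 < q) (hpq : Int.gcd p q = 1)
    (hqodd : Odd q) (hpgt : Odd p → q < p)
    (hth : p * h - q * t = 1) (hh1 : 1 ≤ h) (hh2 : h ≤ q - 1) :
    0 ≤ (p - 2 * t) * (q - 2 * h) ∧
    ((p - 2 * t) * (q - 2 * h) = 0 ↔ p = 2) ∧
    (p = 2 → p - 2 * t = 0 ∧ q - 2 * h = -1) := by
  have key : q * (p - 2 * t) = p * (q - 2 * h) + 2 := by linarith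
  have hb : q - 2 * h ≠ 0 := by
    obtain ⟨k, rfl⟩ := hqodd
    lia
  have htwo : p = 2 → p - 2 * t = 0 ∧ q - 2 * h = -1 := by
    rintro rfl
    have h0 : 0 < t := by nlinarith
    have h2 : t < 2 := by nlinarith
    obtain rfl : t = 1 := by lia
    constructor <;> lia
  refine ⟨?_, ⟨fun hab => ?_, fun hp2 => by rw [(htwo hp2).1, zero_mul]⟩, htwo⟩
  · rcases lt_or_gt_of_ne hb with hneg | hpos
    · refine mul_nonneg_of_nonpos_of_nonpos ?_ hneg.le
      by_contra! ha
      nlinarith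
    · refine mul_nonneg ?_ hpos.le
      by_contra! ha
      nlinarith
  · have ha : p - 2 * t = 0 := (mul_eq_zero.mp hab).resolve_right hb
    rw [ha, mul_zero] at key
    have hle : p ≤ 2 := Int.le_of_dvd two_pos ⟨-(q - 2 * h), by linarith⟩
    lia
end

section
/- Let q ≥ 3 be an odd integer and p > 1 an integer with gcd(p,q) = 1 and p > q if p is odd. Then the pinch move applied to (p,q) yields a pair of the form (p₀, 1) for some integer p₀ ≥ 0 if and only if p = p₀·q − 2ε for some integer p₀ ≥ 0 and some ε ∈ {1, −1} with ε = −1 whenever p₀ ∈ {0, 1}; moreover, in that case the pinch move is an ε-move and its output is exactly (p₀, 1). -/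
/-- If `q` is odd, `|y| ≤ q - 2` and `(p₀ * q - 2 * ε) * y = q * x - 2` with `ε = ±1`,
then `(x, y) = (ε * p₀, ε)`. -/
theorem eq_of_pinch_identity {q p₀ ε x y : ℤ} (hq : Odd q) (hε : ε = 1 ∨ ε = -1)
    (hy₁ : 2 - q ≤ y) (hy₂ : y ≤ q - 2) (hxy : (p₀ * q - 2 * ε) * y = q * x - 2) :
    x = ε * p₀ ∧ y = ε := by
  have hmul : q * (x - p₀ * y) = 2 * (1 - ε * y) := by linear_combination -hxy
  obtain ⟨m, hm⟩ : (2 : ℤ) ∣ x - p₀ * y :=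
    (Int.isCoprime_two_left.2 hq).dvd_of_dvd_mul_left ⟨_, hmul⟩
  rw [hm] at hmul
  have hqm : q * m = 1 - ε * y := by linarith
  have hm0 : m = 0 := by
    have hlt : m < 1 := by
      by_contra! hge
      rcases hε with rfl | rfl <;> nlinarith
    have hgt : -1 < m := by
      by_contra! hle
      rcases hε with rfl | rfl <;> nlinarith
    lia
  subst hm0
  have hyε : y = ε := by rcases hε with rfl | rfl <;> linarith
  subst hyε
  exact ⟨by linarith, rfl⟩

/-- For `q ≥ 3` odd and `p > 1` coprime to `q` with `p > q` if `p` is odd, and `t, h`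
the unique integers with `p*h - q*t = 1`, `1 ≤ h ≤ q - 1`: the pinch move applied to
`(p,q)` yields a pair `(p₀, 1)` with `p₀ ≥ 0` iff `p = p₀*q - 2ε` for some `p₀ ≥ 0`
and `ε ∈ {1,-1}` with `ε = -1` whenever `p₀ ∈ {0,1}`; moreover in that case the move
is an `ε`-move with output exactly `(p₀, 1)`. -/
theorem stmt_5 (p q : ℤ) (hq3 : 3 ≤ q) (hqodd : Odd q) (hp : 1 < p)
    (hpq : Int.gcd p q = 1) (hpgt : Odd p → q < p)
    (t h : ℤ) (hth : p * h - q * t = 1) (hh1 : 1 ≤ h) (hh2 : h ≤ q - 1) :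
    ((∃ p₀ : ℤ, 0 ≤ p₀ ∧ |p - 2 * t| = p₀ ∧ |q - 2 * h| = 1) ↔
      (∃ p₀ ε : ℤ, 0 ≤ p₀ ∧ (ε = 1 ∨ ε = -1) ∧ ((p₀ = 0 ∨ p₀ = 1) → ε = -1) ∧
        p = p₀ * q - 2 * ε)) ∧
    (∀ p₀ ε : ℤ, 0 ≤ p₀ → (ε = 1 ∨ ε = -1) → ((p₀ = 0 ∨ p₀ = 1) → ε = -1) →
      p = p₀ * q - 2 * ε →
      0 ≤ ε * (p - 2 * t) ∧ 0 ≤ ε * (q - 2 * h) ∧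
      |p - 2 * t| = p₀ ∧ |q - 2 * h| = 1) := by
  have hid : p * (q - 2 * h) = q * (p - 2 * t) - 2 := by linear_combination -2 * hth
  have move : ∀ p₀ ε : ℤ, 0 ≤ p₀ → (ε = 1 ∨ ε = -1) → p = p₀ * q - 2 * ε →
      0 ≤ ε * (p - 2 * t) ∧ 0 ≤ ε * (q - 2 * h) ∧
      |p - 2 * t| = p₀ ∧ |q - 2 * h| = 1 := by
    intro p₀ ε hp₀ hε hpε
    obtain ⟨hx, hy⟩ := eq_of_pinch_identity hqodd hε (by linarith) (by linarith)
      (show (p₀ * q - 2 * ε) * (q - 2 * h) = q * (p - 2 * t) - 2 by rw [← hpε, hid])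
    rw [hx, hy]
    rcases hε with rfl | rfl <;> simp [hp₀, abs_of_nonneg]
  refine ⟨⟨?_, ?_⟩, fun p₀ ε hp₀ hε _ hpε => move p₀ ε hp₀ hε hpε⟩
  · rintro ⟨_, -, -, hy⟩
    rcases (abs_eq zero_le_one).1 hy with hy | hy <;> rw [hy] at hid
    · have hpos : 0 < p - 2 * t := by
        by_contra! hle
        nlinarith
      refine ⟨p - 2 * t, 1, hpos.le, Or.inl rfl, ?_, by linarith⟩
      rintro (h0 | h1)
      · lia
      · rw [h1] at hid
        have hpodd : Odd p := by
          obtain ⟨k, hk⟩ := hqodd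
          exact ⟨k - 1, by linarith⟩
        linarith [hpgt hpodd]
    · refine ⟨-(p - 2 * t), -1, ?_, Or.inr rfl, fun _ => rfl, by linarith⟩
      by_contra! hlt
      nlinarith
  · rintro ⟨p₀, ε, hp₀, hε, -, hpε⟩
    obtain ⟨-, -, hx, hy⟩ := move p₀ ε hp₀ hε hpε
    exact ⟨p₀, hp₀, hx, hy⟩
end

section
/- Let p, q > 1 be relatively prime integers with q odd and p > q if p is odd. Suppose there are pairs of nonnegative integers (p_k, q_k) for k = 0, 1, …, n with (p_n, q_n) = (p, q), such that for each 1 ≤ k ≤ n one has p_k, q_k ≥ 2, gcd(p_k, q_k) = 1, and (p_{k−1}, q_{k−1}) is obtained from (p_k, q_k) by an ε_k-move for some ε_k ∈ {1, −1}, and such that min(p₀, q₀) ≤ 1. Then: (a) q₀ = 1; (b) p₀ ≥ 0 and ε₁ = −1 whenever p₀ ∈ {0, 1}; (c) q₁ is odd and q₁ ≥ 3; (d) p₁ = p₀·q₁ − 2ε₁; and (e) there exist even integers m₁, …, m_{n−1} with m_k ≥ 2 such that p_k = m_{k−1}·p_{k−1} − ε_{k−1}ε_k·p_{k−2} and q_k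 = m_{k−1}·q_{k−1} − ε_{k−1}ε_k·q_{k−2} for all 2 ≤ k ≤ n. -/
/-- An `ε`-move yields a pair of determinant `-2 * ε` with the original one, lowers the second
coordinate and preserves parities. -/
lemma pinch_move_facts {a b a' b' ε t h : ℤ} (hε : ε = 1 ∨ ε = -1)
    (hdet : a * h - b * t = 1) (h1 : 1 ≤ h) (h2 : h ≤ b - 1)
    (hx : 0 ≤ ε * (a - 2 * t)) (hy : 0 ≤ ε * (b - 2 * h))
    (ha' : a' = |a - 2 * t|) (hb' : b' = |b - 2 * h|) :
    a * b' - b * a' = -2 * ε ∧ b' < b ∧ (Odd b ↔ Odd b') ∧ (Odd a ↔ Odd a') := by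
  obtain ⟨rfl, rfl⟩ : a' = ε * (a - 2 * t) ∧ b' = ε * (b - 2 * h) := by
    rcases hε with rfl | rfl
    · rw [ha', hb', abs_of_nonneg (by linarith), abs_of_nonneg (by linarith)]
      constructor <;> ring
    · rw [ha', hb', abs_of_nonpos (by linarith), abs_of_nonpos (by linarith)]
      constructor <;> ring
  refine ⟨by linear_combination -2 * ε * hdet, ?_, ?_, ?_⟩
  · rcases hε with rfl | rfl <;> linarith
  · rcases hε with rfl | rfl <;> simp only [Int.odd_iff] <;> omega
  · rcases hε with rfl | rfl <;> simp only [Int.odd_iff] <;> omega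

/-- An `ε`-move on odd pairs cannot reverse the order of the coordinates, and it ends on the
diagonal only at `(1, 1)`. -/
lemma pinch_move_order {a b a' b' ε : ℤ} (hε : ε = 1 ∨ ε = -1)
    (hdet : a * b' - b * a' = -2 * ε) (hb : 0 < b) (hb' : 0 < b')
    (ha_odd : Odd a) (hb_odd : Odd b) (ha'_odd : Odd a') (hb'_odd : Odd b') (hab : b < a) :
    b' < a' ∨ (a' = 1 ∧ b' = 1) := by
  rw [Int.odd_iff] at *
  have hab2 : b + 2 ≤ a := by omega
  have hε2 : -2 * ε ≤ 2 := by rcases hε with rfl | rfl <;> norm_num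
  rcases lt_trichotomy b' a' with h | h | h
  · exact Or.inl h
  · subst h
    right
    have : b' ≤ 1 := by nlinarith
    omega
  · have : a' + 2 ≤ b' := by omega
    nlinarith

/-- A vector proportional to a primitive vector is an integral multiple of it. -/
lemma exists_eq_mul_of_coprime {a b x y : ℤ} (hab : IsCoprime a b)
    (h : x * b = y * a) : ∃ m, x = m * a ∧ y = m * b := by
  obtain ⟨u, v, huv⟩ := hab
  exact ⟨u * x + v * y, by linear_combination (-x) * huv + v * h,
    by linear_combination (-y) * huv - u * h⟩

/-- Structure of a sequence of pinch moves reducing `T(p,q)` to an unknot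
(Theorem on reversing pinch moves, forward direction). -/
theorem stmt_6 (p q : ℤ) (hp : 1 < p) (hq : 1 < q) (hpq : Int.gcd p q = 1)
    (hqodd : Odd q) (hpgt : Odd p → q < p)
    (n : ℕ) (P Q ε : ℕ → ℤ)
    (hPn : P n = p) (hQn : Q n = q)
    (hnonneg : ∀ k ≤ n, 0 ≤ P k ∧ 0 ≤ Q k)
    (hstep : ∀ k, 1 ≤ k → k ≤ n →
      2 ≤ P k ∧ 2 ≤ Q k ∧ Int.gcd (P k) (Q k) = 1 ∧ (ε k = 1 ∨ ε k = -1) ∧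
      ∃ t h : ℤ, P k * h - Q k * t = 1 ∧ 1 ≤ h ∧ h ≤ Q k - 1 ∧
        0 ≤ ε k * (P k - 2 * t) ∧ 0 ≤ ε k * (Q k - 2 * h) ∧
        P (k - 1) = |P k - 2 * t| ∧ Q (k - 1) = |Q k - 2 * h|)
    (hend : min (P 0) (Q 0) ≤ 1) :
    Q 0 = 1 ∧
    (0 ≤ P 0 ∧ ((P 0 = 0 ∨ P 0 = 1) → ε 1 = -1)) ∧
    (Odd (Q 1) ∧ 3 ≤ Q 1) ∧
    P 1 = P 0 * Q 1 - 2 * ε 1 ∧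
    ∃ m : ℕ → ℤ, (∀ k, 1 ≤ k → k ≤ n - 1 → Even (m k) ∧ 2 ≤ m k) ∧
      ∀ k, 2 ≤ k → k ≤ n →
        P k = m (k - 1) * P (k - 1) - ε (k - 1) * ε k * P (k - 2) ∧
        Q k = m (k - 1) * Q (k - 1) - ε (k - 1) * ε k * Q (k - 2) := by
  have hn : 1 ≤ n := by
    rcases Nat.eq_zero_or_pos n with rfl | h
    · rw [hPn, hQn] at hend
      exact absurd hend (not_le.mpr (lt_min hp hq))
    · exact h
  have hsign : ∀ k, k + 1 ≤ n → ε (k + 1) = 1 ∨ ε (k + 1) = -1 := fun k hk =>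
    (hstep (k + 1) (by omega) hk).2.2.2.1
  have hfacts : ∀ k, k + 1 ≤ n →
      P (k + 1) * Q k - Q (k + 1) * P k = -2 * ε (k + 1) ∧ Q k < Q (k + 1) ∧
      (Odd (Q (k + 1)) ↔ Odd (Q k)) ∧ (Odd (P (k + 1)) ↔ Odd (P k)) := by
    intro k hk
    obtain ⟨-, -, -, hε, t, h, hdet, h1, h2, hx, hy, hP, hQ⟩ := hstep (k + 1) (by omega) hk
    exact pinch_move_facts hε hdet h1 h2 hx hy hP hQ
  have hQodd : ∀ k ≤ n, Odd (Q k) := fun k hk =>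
    Nat.decreasingInduction' (P := fun k => Odd (Q k))
      (fun j hj _ ih => (hfacts j hj).2.2.1.mp ih) hk (hQn ▸ hqodd)
  have hQpos : ∀ k ≤ n, 0 < Q k := by
    intro k hk
    have := (hnonneg k hk).2
    have := Int.odd_iff.mp (hQodd k hk)
    omega
  obtain ⟨hdet0, hlt0, -, -⟩ := hfacts 0 hn
  rw [zero_add] at hdet0 hlt0
  have hε1 : ε 1 = 1 ∨ ε 1 = -1 := hsign 0 hn
  have hP1 : 2 ≤ P 1 := (hstep 1 le_rfl hn).1
  have hP_one : P 0 = 1 → Q 0 = 1 ∧ ε 1 = -1 := by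
    intro h0
    have hPodd : ∀ k ≤ n, Odd (P k) := by
      intro k
      induction k with
      | zero => intro _; rw [h0]; exact odd_one
      | succ k ih => intro hk; exact (hfacts k hk).2.2.2.mpr (ih (by omega))
    have hstep_order : ∀ k, k + 1 ≤ n → Q (k + 1) < P (k + 1) →
        Q k < P k ∨ (P k = 1 ∧ Q k = 1) := fun k hk =>
      pinch_move_order (hsign k hk) (hfacts k hk).1 (hQpos _ hk) (hQpos _ (by omega))
        (hPodd _ hk) (hQodd _ hk) (hPodd _ (by omega)) (hQodd _ (by omega))
    have horder : Q 1 < P 1 := by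
      refine Nat.decreasingInduction' (P := fun k => Q k < P k) (fun j hj hj1 ih => ?_) hn ?_
      · rcases hstep_order j hj ih with h | ⟨h, -⟩
        · exact h
        · have := (hstep j hj1 hj.le).1
          omega
      · rw [hPn, hQn]
        exact hpgt (hPn ▸ hPodd n le_rfl)
    have hQ0 : Q 0 = 1 := by
      have := hQpos 0 (by omega)
      rcases hstep_order 0 hn horder with h | ⟨-, h⟩ <;> omega
    refine ⟨hQ0, ?_⟩
    rcases hε1 with h | h
    · rw [h, h0, hQ0] at hdet0
      linarith
    · exact h
  have hP_zero : P 0 = 0 → Q 0 = 1 ∧ ε 1 = -1 := by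
    intro h0
    have hpos := hQpos 0 (by omega)
    have hodd := Int.odd_iff.mp (hQodd 0 (by omega))
    rw [h0, mul_zero, sub_zero] at hdet0
    rcases hε1 with h | h
    · rw [h] at hdet0
      nlinarith
    · rw [h] at hdet0
      have : Q 0 ≤ 1 := by nlinarith
      exact ⟨by omega, h⟩
  have hP0 := (hnonneg 0 (by omega)).1
  have hQ0 : Q 0 = 1 := by
    rcases min_le_iff.mp hend with h | h
    · rcases (show P 0 = 0 ∨ P 0 = 1 by omega) with h | h
      · exact (hP_zero h).1
      · exact (hP_one h).1
    · have := hQpos 0 (by omega)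
      omega
  have hmult : ∀ k, ∃ m : ℤ, k + 2 ≤ n → (Even m ∧ 2 ≤ m) ∧
      P (k + 2) = m * P (k + 1) - ε (k + 1) * ε (k + 2) * P k ∧
      Q (k + 2) = m * Q (k + 1) - ε (k + 1) * ε (k + 2) * Q k := by
    intro k
    by_cases hk : k + 2 ≤ n
    swap
    · exact ⟨0, fun h => absurd h hk⟩
    obtain ⟨hdet, hlt, -, -⟩ := hfacts k (by omega)
    obtain ⟨hdet', hlt', -, -⟩ := hfacts (k + 1) hk
    rw [add_assoc, one_add_one_eq_two] at hdet' hlt'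
    have hsq : ε (k + 1) * ε (k + 1) = 1 := by
      rcases hsign k (by omega) with h | h <;> rw [h] <;> norm_num
    obtain ⟨m, hmP, hmQ⟩ := exists_eq_mul_of_coprime
      (x := P (k + 2) + ε (k + 1) * ε (k + 2) * P k)
      (y := Q (k + 2) + ε (k + 1) * ε (k + 2) * Q k)
      (Int.isCoprime_iff_gcd_eq_one.mpr (hstep (k + 1) (by omega) (by omega)).2.2.1)
      (by linear_combination hdet' - ε (k + 1) * ε (k + 2) * hdet + 2 * ε (k + 2) * hsq)
    refine ⟨m, fun _ => ⟨?_, by linarith, by linarith⟩⟩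
    have hQk := hQpos k (by omega)
    have hQk1 := hQpos (k + 1) (by omega)
    have hprod : Even (m * Q (k + 1)) ∧ 0 < m * Q (k + 1) := by
      rw [← hmQ]
      have hodd := hQodd k (by omega)
      have hodd2 := hQodd (k + 2) hk
      rw [Int.odd_iff] at hodd hodd2
      rw [Int.even_iff]
      rcases hsign k (by omega) with h | h <;> rcases hsign (k + 1) hk with h' | h' <;>
        rw [add_assoc, one_add_one_eq_two] at h' <;> rw [h, h'] <;> constructor <;> omega
    have hmpos : 0 < m := pos_of_mul_pos_left hprod.2 hQk1.le
    have hmeven : Even m := (Int.even_mul.mp hprod.1).resolve_right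
      (Int.not_even_iff_odd.mpr (hQodd _ (by omega)))
    refine ⟨hmeven, ?_⟩
    rw [Int.even_iff] at hmeven
    omega
  choose m hm using hmult
  refine ⟨hQ0, ⟨hP0, ?_⟩, ⟨hQodd 1 hn, ?_⟩, ?_, fun k => m (k - 1), ?_, ?_⟩
  · rintro (h | h)
    · exact (hP_zero h).2
    · exact (hP_one h).2
  · have := Int.odd_iff.mp (hQodd 1 hn)
    omega
  · rw [hQ0] at hdet0
    linear_combination hdet0
  · intro k hk1 hkn
    exact (hm (k - 1) (by omega)).1
  · intro k hk2 hkn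
    obtain ⟨j, rfl⟩ := Nat.exists_eq_add_of_le' hk2
    exact (hm j hkn).2
end

section
/- Given pinch-move data, for every 0 ≤ k ≤ n the integers p_k and q_k are relatively prime and q_k is odd; for every 1 ≤ k ≤ n one has p_k ≥ 2 and q_k ≥ 3; and for every 1 ≤ k ≤ n, the pinch move applied to (p_k, q_k) is an ε_k-move whose output is exactly (p_{k−1}, q_{k−1}). -/
/-- The relation between consecutive pairs `(a, b)` and `(c, d)`, the former being the result
of an `e`-move on the latter. -/
structure PinchStep (e a b c d : ℤ) : Prop where
  fst_nonneg : 0 ≤ a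
  fst_lt : a < c
  two_le : 2 ≤ c
  snd_pos : 1 ≤ b
  snd_lt : b < d
  three_le : 3 ≤ d
  odd_left : Odd b
  odd_right : Odd d
  even_sub : Even (c - a)
  det : c * b - d * a = -2 * e

theorem PinchStep.initial {e a d : ℤ} (ha : 0 ≤ a) (hd : Odd d) (hd3 : 3 ≤ d)
    (he : e = 1 ∨ e = -1) (hea : a = 0 ∨ a = 1 → e = -1) :
    PinchStep e a 1 (a * d - 2 * e) d := by
  have hlt : a < a * d - 2 * e ∧ 2 ≤ a * d - 2 * e := by
    by_cases h : a = 0 ∨ a = 1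
    · rw [hea h]
      rcases h with rfl | rfl <;> constructor <;> linarith
    · have h2 : 2 ≤ a := by omega
      rcases he with rfl | rfl <;> constructor <;> nlinarith
  refine ⟨ha, hlt.1, hlt.2, le_rfl, by linarith, hd3, odd_one, hd, ?_, by ring⟩
  obtain ⟨r, rfl⟩ := hd
  exact ⟨a * r - e, by ring⟩

theorem PinchStep.next {e e' a b c d m : ℤ} (h : PinchStep e a b c d) (he : e = 1 ∨ e = -1)
    (he' : e' = 1 ∨ e' = -1) (hm : Even m) (hm2 : 2 ≤ m) :
    PinchStep e' c d (m * c - e * e' * a) (m * d - e * e' * b) := by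
  obtain ⟨ha, hac, hc, hb, hbd, hd, ob, od, hev, hdet⟩ := h
  have hee : e * e = 1 := by rcases he with rfl | rfl <;> norm_num
  have hs : e * e' = 1 ∨ e * e' = -1 := by
    rcases he with rfl | rfl <;> rcases he' with rfl | rfl <;> norm_num
  have hlt : c < m * c - e * e' * a := by rcases hs with h | h <;> rw [h] <;> nlinarith
  have hlt' : d < m * d - e * e' * b := by rcases hs with h | h <;> rw [h] <;> nlinarith
  have hso : Odd (e * e') := by rcases hs with h | h <;> rw [h] <;> decide
  refine ⟨by linarith, hlt, by linarith, by linarith, hlt', by linarith, od,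
    (hm.mul_right d).sub_odd (hso.mul ob), ?_, ?_⟩
  · have h1 : Even (e * e' + 1) := hso.add_one
    have h2 : m * c - e * e' * a - c = m * c + e * e' * (c - a) - (e * e' + 1) * c := by ring
    rw [h2]
    exact ((hm.mul_right c).add (hev.mul_left _)).sub (h1.mul_right c)
  · linear_combination e * e' * hdet - 2 * e' * hee

theorem PinchStep.exists_move {e a b c d : ℤ} (h : PinchStep e a b c d) (he : e = 1 ∨ e = -1) :
    ∃ t h : ℤ, c * h - d * t = 1 ∧ 1 ≤ h ∧ h ≤ d - 1 ∧
      0 ≤ e * (c - 2 * t) ∧ 0 ≤ e * (d - 2 * h) ∧ |c - 2 * t| = a ∧ |d - 2 * h| = b := by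
  obtain ⟨ha, hac, hc, hb, hbd, hd, ob, od, ⟨r, hr⟩, hdet⟩ := h
  obtain ⟨s, hs⟩ := od.sub_odd ob
  obtain rfl : c = a + 2 * r := by linarith
  obtain rfl : d = b + 2 * s := by linarith
  rcases he with rfl | rfl
  · refine ⟨r, s, by linarith, by linarith, by linarith, by linarith, by linarith, ?_, ?_⟩
    · rw [add_sub_cancel_right, abs_of_nonneg ha]
    · rw [add_sub_cancel_right, abs_of_nonneg (by linarith)]
  · refine ⟨a + r, b + s, by linarith, by linarith, by linarith, by linarith, by linarith, ?_, ?_⟩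
    · rw [show a + 2 * r - 2 * (a + r) = -a by ring, abs_neg, abs_of_nonneg ha]
    · rw [show b + 2 * s - 2 * (b + s) = -b by ring, abs_neg, abs_of_nonneg (by linarith)]

/-- Given pinch-move data: each pair `(p k, q k)` is relatively prime with `q k` odd,
`p k ≥ 2` and `q k ≥ 3` for `1 ≤ k ≤ n`, and the pinch move on `(p k, q k)` is an
`ε k`-move with output exactly `(p (k-1), q (k-1))`. -/
theorem stmt_7
    (n : ℕ) (hn : 1 ≤ n) (p q ε m : ℕ → ℤ)
    (hq0 : q 0 = 1) (hp0 : 0 ≤ p 0)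
    (hq1odd : Odd (q 1)) (hq1 : 3 ≤ q 1)
    (hε : ∀ k, 1 ≤ k → k ≤ n → ε k = 1 ∨ ε k = -1)
    (hε1 : p 0 = 0 ∨ p 0 = 1 → ε 1 = -1)
    (hm : ∀ k, 1 ≤ k → k ≤ n - 1 → Even (m k) ∧ 2 ≤ m k)
    (hp1 : p 1 = p 0 * q 1 - 2 * ε 1)
    (hrec : ∀ k, 2 ≤ k → k ≤ n →
      p k = m (k - 1) * p (k - 1) - ε (k - 1) * ε k * p (k - 2) ∧
      q k = m (k - 1) * q (k - 1) - ε (k - 1) * ε k * q (k - 2)) :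
    (∀ k ≤ n, Int.gcd (p k) (q k) = 1 ∧ Odd (q k)) ∧
    (∀ k, 1 ≤ k → k ≤ n → 2 ≤ p k ∧ 3 ≤ q k) ∧
    (∀ k, 1 ≤ k → k ≤ n → ∃ t h : ℤ,
      p k * h - q k * t = 1 ∧ 1 ≤ h ∧ h ≤ q k - 1 ∧
      0 ≤ ε k * (p k - 2 * t) ∧ 0 ≤ ε k * (q k - 2 * h) ∧
      |p k - 2 * t| = p (k - 1) ∧ |q k - 2 * h| = q (k - 1)) := by
  have step : ∀ j, j + 1 ≤ n → PinchStep (ε (j + 1)) (p j) (q j) (p (j + 1)) (q (j + 1)) := by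
    intro j
    induction j with
    | zero =>
      intro _
      rw [zero_add, hp1, hq0]
      exact .initial hp0 hq1odd hq1 (hε 1 le_rfl hn) hε1
    | succ j ih =>
      intro hj
      obtain ⟨h1, h2⟩ := hrec (j + 2) (by omega) hj
      obtain ⟨hm1, hm2⟩ := hm (j + 1) (by omega) (by omega)
      have := (ih (by omega)).next (hε (j + 1) (by omega) (by omega))
        (hε (j + 2) (by omega) hj) hm1 hm2
      simp only [Nat.add_sub_cancel, show j + 2 - 1 = j + 1 from rfl] at h1 h2
      rwa [← h1, ← h2] at this
  have move : ∀ k, 1 ≤ k → k ≤ n → ∃ t h : ℤ,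
      p k * h - q k * t = 1 ∧ 1 ≤ h ∧ h ≤ q k - 1 ∧
      0 ≤ ε k * (p k - 2 * t) ∧ 0 ≤ ε k * (q k - 2 * h) ∧
      |p k - 2 * t| = p (k - 1) ∧ |q k - 2 * h| = q (k - 1) := by
    rintro (_ | j) h1 hk
    · omega
    · exact (step j hk).exists_move (hε _ h1 hk)
  refine ⟨?_, ?_, move⟩
  · rintro (_ | j) hk
    · simp [hq0]
    · obtain ⟨t, h, hth, -⟩ := move (j + 1) (by omega) hk
      refine ⟨Int.isCoprime_iff_gcd_eq_one.mp ⟨h, -t, by linarith⟩, (step j hk).odd_right⟩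
  · rintro (_ | j) h1 hk
    · omega
    · exact ⟨(step j hk).two_le, (step j hk).three_le⟩
end

section
/- Given pinch-move data, for each 1 ≤ k ≤ n define h_k = (q_k − ε_k·q_{k−1})/2 and t_k = (p_k − ε_k·p_{k−1})/2. Then h_k and t_k are integers, p_k·h_k − q_k·t_k = 1, and 1 ≤ h_k ≤ q_k − 1. -/
/-- One step of the pinch-move recursion preserves parity, growth and the determinant. -/
theorem pinch_step {p₀ p₁ p₂ q₀ q₁ q₂ m e f : ℤ} (he : e = 1 ∨ e = -1) (hf : f = 1 ∨ f = -1)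
    (hm : Even m) (hm2 : 2 ≤ m) (hp : p₂ = m * p₁ - e * f * p₀) (hq : q₂ = m * q₁ - e * f * q₀)
    (hpe : Even (p₁ - p₀)) (hqe : Even (q₁ - q₀)) (hpos : 1 ≤ q₀) (hlt : q₀ < q₁)
    (hdet : p₁ * q₀ - q₁ * p₀ = -2 * e) :
    Even (p₂ - p₁) ∧ Even (q₂ - q₁) ∧ 1 ≤ q₁ ∧ q₁ < q₂ ∧ p₂ * q₁ - q₂ * p₁ = -2 * f := by
  have hef : e * f = 1 ∨ e * f = -1 := by
    rcases he with rfl | rfl <;> rcases hf with rfl | rfl <;> simp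
  have hee : e * e = 1 := by rcases he with rfl | rfl <;> simp
  have heo : ¬ Even (e * f) := by rcases hef with h | h <;> rw [h] <;> decide
  refine ⟨?_, ?_, by linarith, ?_, ?_⟩
  · subst hp
    simp only [Int.even_sub, Int.even_mul (n := p₁), Int.even_mul (n := p₀)] at *
    tauto
  · subst hq
    simp only [Int.even_sub, Int.even_mul (n := q₁), Int.even_mul (n := q₀)] at *
    tauto
  · have : 2 * q₁ ≤ m * q₁ := mul_le_mul_of_nonneg_right hm2 (by linarith)
    rcases hef with h | h <;> rw [hq, h] <;> linarith
  · subst hp hq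
    linear_combination e * f * hdet - 2 * f * hee

/-- Given pinch-move data, for `1 ≤ k ≤ n` the quantities
`hk = (q k - ε k * q (k-1))/2` and `tk = (p k - ε k * p (k-1))/2` are integers
satisfying `p k * hk - q k * tk = 1` and `1 ≤ hk ≤ q k - 1`. -/
theorem stmt_8
    (n : ℕ) (hn : 1 ≤ n) (p q ε m : ℕ → ℤ)
    (hq0 : q 0 = 1) (hp0 : 0 ≤ p 0)
    (hq1odd : Odd (q 1)) (hq1 : 3 ≤ q 1)
    (hε : ∀ k, 1 ≤ k → k ≤ n → ε k = 1 ∨ ε k = -1)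
    (hε1 : p 0 = 0 ∨ p 0 = 1 → ε 1 = -1)
    (hm : ∀ k, 1 ≤ k → k ≤ n - 1 → Even (m k) ∧ 2 ≤ m k)
    (hp1 : p 1 = p 0 * q 1 - 2 * ε 1)
    (hrec : ∀ k, 2 ≤ k → k ≤ n →
      p k = m (k - 1) * p (k - 1) - ε (k - 1) * ε k * p (k - 2) ∧
      q k = m (k - 1) * q (k - 1) - ε (k - 1) * ε k * q (k - 2)) :
    ∀ k, 1 ≤ k → k ≤ n → ∃ tk hk : ℤ,
      2 * hk = q k - ε k * q (k - 1) ∧ 2 * tk = p k - ε k * p (k - 1) ∧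
      p k * hk - q k * tk = 1 ∧ 1 ≤ hk ∧ hk ≤ q k - 1 := by
  have key : ∀ j, j + 1 ≤ n → Even (p (j + 1) - p j) ∧ Even (q (j + 1) - q j) ∧ 1 ≤ q j ∧
      q j < q (j + 1) ∧ p (j + 1) * q j - q (j + 1) * p j = -2 * ε (j + 1) := by
    intro j
    induction j with
    | zero =>
      intro _
      obtain ⟨c, hc⟩ := hq1odd
      simp only [zero_add, hq0, hp1]
      refine ⟨⟨p 0 * c - ε 1, ?_⟩, ⟨c, ?_⟩, le_rfl, by linarith, by ring⟩
      · rw [hc]; ring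
      · rw [hc]; ring
    | succ j ih =>
      intro hj
      obtain ⟨hpe, hqe, hpos, hlt, hdet⟩ := ih (by omega)
      obtain ⟨hme, hm2⟩ := hm (j + 1) (by omega) (by omega)
      obtain ⟨hp, hq⟩ := hrec (j + 2) (by omega) hj
      exact pinch_step (hε _ (by omega) (by omega)) (hε _ (by omega) hj) hme hm2 hp hq
        hpe hqe hpos hlt hdet
  intro k hk hkn
  obtain ⟨j, rfl⟩ := Nat.exists_eq_add_of_le' hk
  obtain ⟨⟨a, ha⟩, ⟨b, hb⟩, hpos, hlt, hdet⟩ := key j hkn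
  rw [Nat.add_sub_cancel]
  rcases hε _ hk hkn with h | h <;> rw [h] at hdet ⊢
  · refine ⟨a, b, by linarith, by linarith, ?_, by omega, by omega⟩
    have : 2 * (p (j + 1) * b - q (j + 1) * a) = 2 := by
      linear_combination q (j + 1) * ha - p (j + 1) * hb - hdet
    linarith
  · refine ⟨a + p j, b + q j, by linarith, by linarith, ?_, by omega, by omega⟩
    have : 2 * (p (j + 1) * (b + q j) - q (j + 1) * (a + p j)) = 2 := by
      linear_combination q (j + 1) * ha - p (j + 1) * hb + hdet
    linarith
end

section
/- Given pinch-move data, define r_j = ε₁(p₀·q_j − p_j)/2 for 0 ≤ j ≤ n. Then each r_j is an integer, r₀ = 0, r₁ = 1, and r_j·q_{j−1} − r_{j−1}·q_j = ε₁·ε_j for every 1 ≤ j ≤ n. -/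
/-- Given pinch-move data, the quantities `r j = ε 1 * (p 0 * q j - p j) / 2` are
integers with `r 0 = 0`, `r 1 = 1`, and
`r j * q (j-1) - r (j-1) * q j = ε 1 * ε j` for `1 ≤ j ≤ n`. -/
theorem stmt_9
    (n : ℕ) (hn : 1 ≤ n) (p q ε m : ℕ → ℤ)
    (hq0 : q 0 = 1) (hp0 : 0 ≤ p 0)
    (hq1odd : Odd (q 1)) (hq1 : 3 ≤ q 1)
    (hε : ∀ k, 1 ≤ k → k ≤ n → ε k = 1 ∨ ε k = -1)
    (hε1 : p 0 = 0 ∨ p 0 = 1 → ε 1 = -1)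
    (hm : ∀ k, 1 ≤ k → k ≤ n - 1 → Even (m k) ∧ 2 ≤ m k)
    (hp1 : p 1 = p 0 * q 1 - 2 * ε 1)
    (hrec : ∀ k, 2 ≤ k → k ≤ n →
      p k = m (k - 1) * p (k - 1) - ε (k - 1) * ε k * p (k - 2) ∧
      q k = m (k - 1) * q (k - 1) - ε (k - 1) * ε k * q (k - 2)) :
    ∃ r : ℕ → ℤ,
      (∀ j ≤ n, 2 * r j = ε 1 * (p 0 * q j - p j)) ∧
      r 0 = 0 ∧ r 1 = 1 ∧
      (∀ j, 1 ≤ j → j ≤ n → r j * q (j - 1) - r (j - 1) * q j = ε 1 * ε j) := by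
  have hsq : ∀ k, 1 ≤ k → k ≤ n → ε k * ε k = 1 := fun k h1 hk => by
    rcases hε k h1 hk with h | h <;> simp [h]
  have heven : ∀ j ≤ n, (2 : ℤ) ∣ ε 1 * (p 0 * q j - p j) := by
    intro j
    induction j using Nat.twoStepInduction with
    | zero => simp [hq0]
    | one => exact fun _ => ⟨ε 1 * ε 1, by rw [hp1]; ring⟩
    | more k ih ih' =>
      intro hk
      obtain ⟨a, ha⟩ := ih (by lia)
      obtain ⟨b, hb⟩ := ih' (by lia)
      obtain ⟨hp, hq⟩ := hrec (k + 2) (by lia) hk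
      simp only [Nat.add_sub_cancel, show k + 2 - 1 = k + 1 from rfl] at hp hq
      refine ⟨m (k + 1) * b - ε (k + 1) * ε (k + 2) * a, ?_⟩
      rw [hp, hq]
      linear_combination m (k + 1) * hb - ε (k + 1) * ε (k + 2) * ha
  have hr : ∀ j ≤ n, 2 * (ε 1 * (p 0 * q j - p j) / 2) = ε 1 * (p 0 * q j - p j) :=
    fun j hj => Int.mul_ediv_cancel' (heven j hj)
  refine ⟨fun j => ε 1 * (p 0 * q j - p j) / 2, hr, by simp [hq0], ?_, ?_⟩
  · have h := hr 1 hn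
    rw [hp1] at h
    have h1 := hsq 1 le_rfl hn
    simp only [hp1]
    linarith
  · intro j h1
    induction j, h1 using Nat.le_induction with
    | base =>
      intro _
      have h := hr 1 hn
      have h0 := hr 0 (by lia)
      simp only [Nat.sub_self]
      rw [hq0] at h0 ⊢
      refine mul_left_cancel₀ two_ne_zero ?_
      linear_combination h - q 1 * h0 - ε 1 * hp1
    | succ k h1 ih =>
      intro hk
      obtain ⟨i, rfl⟩ := Nat.exists_eq_add_of_le' h1
      have ih := ih (by lia)
      have h2 := hr (i + 2) hk
      have hb := hr (i + 1) (by lia)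
      have ha := hr i (by lia)
      have hs := hsq (i + 1) (by lia) (by lia)
      obtain ⟨hp, hq⟩ := hrec (i + 2) (by lia) hk
      simp only [Nat.add_sub_cancel, show i + 2 - 1 = i + 1 from rfl,
        show i + 1 + 1 = i + 2 from rfl] at hp hq ih ⊢
      generalize ε 1 * (p 0 * q (i + 2) - p (i + 2)) / 2 = c at *
      generalize ε 1 * (p 0 * q (i + 1) - p (i + 1)) / 2 = b at *
      generalize ε 1 * (p 0 * q i - p i) / 2 = a at *
      have hc : c = m (i + 1) * b - ε (i + 1) * ε (i + 2) * a := by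
        refine mul_left_cancel₀ two_ne_zero ?_
        linear_combination h2 - m (i + 1) * hb + ε (i + 1) * ε (i + 2) * ha
          + ε 1 * p 0 * hq - ε 1 * hp
      linear_combination q (i + 1) * hc - b * hq + ε (i + 1) * ε (i + 2) * ih
        + ε 1 * ε (i + 2) * hs
end

section
/- Given pinch-move data with n ≥ 2 and the associated doubly indexed sequence ρ, one has ρ_{k,k−1} = 0 and ρ_{k,k} = 1 for all 1 ≤ k ≤ n, and ρ_{k,k+1} = m_k for all 1 ≤ k ≤ n − 1. -/
/-- Given pinch-move data with `n ≥ 2`: `ρ k (k-1) = 0` and `ρ k k = 1` for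
`1 ≤ k ≤ n`, and `ρ k (k+1) = m k` for `1 ≤ k ≤ n - 1`. -/
theorem stmt_11
    (n : ℕ) (hn : 2 ≤ n) (p q ε m : ℕ → ℤ)
    (hq0 : q 0 = 1) (hp0 : 0 ≤ p 0)
    (hq1odd : Odd (q 1)) (hq1 : 3 ≤ q 1)
    (hε : ∀ k, 1 ≤ k → k ≤ n → ε k = 1 ∨ ε k = -1)
    (hε1 : p 0 = 0 ∨ p 0 = 1 → ε 1 = -1)
    (hm : ∀ k, 1 ≤ k → k ≤ n - 1 → Even (m k) ∧ 2 ≤ m k)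
    (hp1 : p 1 = p 0 * q 1 - 2 * ε 1)
    (hrec : ∀ k, 2 ≤ k → k ≤ n →
      p k = m (k - 1) * p (k - 1) - ε (k - 1) * ε k * p (k - 2) ∧
      q k = m (k - 1) * q (k - 1) - ε (k - 1) * ε k * q (k - 2))
    (ρ : ℕ → ℕ → ℤ)
    (hρ1 : ∀ j ≤ n, 2 * ρ 1 j = ε 1 * (p 0 * q j - p j))
    (hρ2 : ∀ j, 1 ≤ j → j ≤ n → ρ 2 j = ε 1 * ε 2 * (q 1 * ρ 1 j - q j))
    (hρ : ∀ k j, 3 ≤ k → k ≤ n → k - 1 ≤ j → j ≤ n →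
      ρ k j = ε (k - 1) * ε k * (m (k - 2) * ρ (k - 1) j - ρ (k - 2) j)) :
    (∀ k, 1 ≤ k → k ≤ n → ρ k (k - 1) = 0 ∧ ρ k k = 1) ∧
    (∀ k, 1 ≤ k → k ≤ n - 1 → ρ k (k + 1) = m k) := by
  have hsq : ∀ k, 1 ≤ k → k ≤ n → ε k * ε k = 1 := fun k h1 h2 => by
    rcases hε k h1 h2 with h | h <;> simp [h]
  have hsq2 : ∀ k, 1 ≤ k → k + 1 ≤ n → ε k * ε (k + 1) * (ε k * ε (k + 1)) = 1 :=
    fun k h1 h2 => by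
      rw [mul_mul_mul_comm, hsq k h1 (by omega), hsq (k + 1) (by omega) h2, one_mul]
  -- Every row of `ρ` satisfies the same three-term recurrence in `j` as `p` and `q`.
  have hrow : ∀ k, k + 1 ≤ n → ∀ j, k ≤ j → j + 2 ≤ n →
      ρ (k + 1) (j + 2) =
        m (j + 1) * ρ (k + 1) (j + 1) - ε (j + 1) * ε (j + 2) * ρ (k + 1) j := by
    intro k
    induction k using Nat.strong_induction_on with
    | _ k ih =>
      intro hk j hkj hj
      obtain ⟨hp, hq⟩ := hrec (j + 2) (by omega) hj
      simp only [Nat.add_sub_cancel, show j + 2 - 1 = j + 1 by omega] at hp hq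
      have row_one : ρ 1 (j + 2) =
          m (j + 1) * ρ 1 (j + 1) - ε (j + 1) * ε (j + 2) * ρ 1 j := by
        have h0 := hρ1 j (by omega)
        have h1 := hρ1 (j + 1) (by omega)
        have h2 := hρ1 (j + 2) hj
        rw [hp, hq] at h2
        refine mul_left_cancel₀ (two_ne_zero (α := ℤ)) ?_
        linear_combination h2 - m (j + 1) * h1 + ε (j + 1) * ε (j + 2) * h0
      match k, ih, hk, hkj with
      | 0, _, _, _ => exact row_one
      | 1, _, _, hkj =>
        rw [hρ2 (j + 2) (by omega) hj, hρ2 (j + 1) (by omega) (by omega),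
          hρ2 j hkj (by omega), hq, row_one]
        ring
      | k + 2, ih, hk, hkj =>
        have hcol := fun i (h1 : k + 2 ≤ i) h2 => hρ (k + 3) i (by omega) hk h1 h2
        simp only [show k + 3 - 1 = k + 2 by omega, show k + 3 - 2 = k + 1 by omega] at hcol
        have ih₁ := ih (k + 1) (by omega) (by omega) j (by omega) hj
        have ih₀ := ih k (by omega) (by omega) j (by omega) hj
        rw [hcol (j + 2) (by omega) hj, hcol (j + 1) (by omega) (by omega),
          hcol j hkj (by omega), ih₁, ih₀]
        ring
  have hdiag : ∀ k, k + 1 ≤ n → ρ (k + 1) k = 0 ∧ ρ (k + 1) (k + 1) = 1 := by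
    intro k
    induction k using Nat.strong_induction_on with
    | _ k ih =>
      intro hk
      have hbase : ρ 1 0 = 0 ∧ ρ 1 1 = 1 := by
        have h0 := hρ1 0 (by omega)
        have h1 := hρ1 1 (by omega)
        rw [hq0] at h0
        rw [hp1] at h1
        have hs := hsq 1 le_rfl (by omega)
        constructor
        · linarith
        · linarith
      match k, ih, hk with
      | 0, _, _ => exact hbase
      | 1, _, _ =>
        obtain ⟨h0, h1⟩ := hbase
        have hs := hsq2 1 le_rfl hn
        have hr := hrow 0 (by omega) 0 le_rfl hn
        have hq := (hrec 2 le_rfl hn).2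
        simp only [zero_add, Nat.sub_self, show 2 - 1 = 1 from rfl, one_add_one_eq_two]
          at hr hq hs ⊢
        rw [h0, h1] at hr
        rw [hq0] at hq
        constructor
        · rw [hρ2 1 le_rfl (by omega), h1]
          ring
        · rw [hρ2 2 (by omega) hn, hr, hq]
          linear_combination hs
      | k + 2, ih, hk =>
        obtain ⟨a0, a1⟩ := ih k (by omega) (by omega)
        obtain ⟨b0, b1⟩ := ih (k + 1) (by omega) (by omega)
        have hs := hsq2 (k + 2) (by omega) hk
        have hcol := fun i (h1 : k + 2 ≤ i) h2 => hρ (k + 3) i (by omega) hk h1 h2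
        simp only [show k + 3 - 1 = k + 2 by omega, show k + 3 - 2 = k + 1 by omega] at hcol
        have r0 := hrow k (by omega) k le_rfl (by omega)
        have r1 := hrow k (by omega) (k + 1) (by omega) hk
        have r2 := hrow (k + 1) (by omega) (k + 1) le_rfl hk
        simp only [add_assoc, Nat.reduceAdd] at a0 a1 b0 b1 hs r0 r1 r2 ⊢
        rw [a0, a1] at r0
        rw [r0, a1] at r1
        rw [b0, b1] at r2
        constructor
        · rw [hcol (k + 2) le_rfl (by omega), b1, r0]
          ring
        · rw [hcol (k + 3) (by omega) hk, r2, r1]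
          linear_combination hs
  refine ⟨fun k h1 hk => ?_, fun k h1 hk => ?_⟩ <;>
    obtain ⟨k, rfl⟩ := Nat.exists_eq_add_of_le' h1
  · exact hdiag k hk
  · obtain ⟨h0, h1⟩ := hdiag k (by omega)
    rw [hrow k (by omega) k le_rfl (by omega), h0, h1]
    ring
end

section
/- Given pinch-move data with n ≥ 2 and the associated doubly indexed sequence ρ, one has the strict inequality ρ_{k,j−1} < ρ_{k,j} for all 1 ≤ k ≤ n and all k ≤ j ≤ n. -/
/-- A sequence starting with `0, 1` at `a, a + 1` and obeying a three-term recurrence with leading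
coefficient at least `2` and trailing coefficient `±1` is nonnegative and strictly increasing. -/
theorem nonneg_and_lt_succ_of_three_term_recurrence {n a : ℕ} {x m c : ℕ → ℤ}
    (hm : ∀ j, a ≤ j → j + 2 ≤ n → 2 ≤ m j)
    (hc : ∀ j, a ≤ j → j + 2 ≤ n → c j ≤ 1)
    (h0 : x a = 0) (h1 : x (a + 1) = 1)
    (hx : ∀ j, a ≤ j → j + 2 ≤ n → x (j + 2) = m j * x (j + 1) - c j * x j)
    (j : ℕ) (haj : a ≤ j) (hjn : j + 1 ≤ n) : 0 ≤ x j ∧ x j < x (j + 1) := by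
  induction j, haj using Nat.le_induction with
  | base => simp [h0, h1]
  | succ j haj ih =>
    obtain ⟨hnonneg, hlt⟩ := ih (by lia)
    refine ⟨by lia, ?_⟩
    rw [hx j haj hjn]
    nlinarith [hm j haj hjn, hc j haj hjn]

/-- Given pinch-move data with `n ≥ 2`, the sequence `ρ k ·` is strictly increasing:
`ρ k (j-1) < ρ k j` for all `1 ≤ k ≤ n` and `k ≤ j ≤ n`. -/
theorem stmt_12
    (n : ℕ) (hn : 2 ≤ n) (p q ε m : ℕ → ℤ)
    (hq0 : q 0 = 1) (hp0 : 0 ≤ p 0)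
    (hq1odd : Odd (q 1)) (hq1 : 3 ≤ q 1)
    (hε : ∀ k, 1 ≤ k → k ≤ n → ε k = 1 ∨ ε k = -1)
    (hε1 : p 0 = 0 ∨ p 0 = 1 → ε 1 = -1)
    (hm : ∀ k, 1 ≤ k → k ≤ n - 1 → Even (m k) ∧ 2 ≤ m k)
    (hp1 : p 1 = p 0 * q 1 - 2 * ε 1)
    (hrec : ∀ k, 2 ≤ k → k ≤ n →
      p k = m (k - 1) * p (k - 1) - ε (k - 1) * ε k * p (k - 2) ∧
      q k = m (k - 1) * q (k - 1) - ε (k - 1) * ε k * q (k - 2))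
    (ρ : ℕ → ℕ → ℤ)
    (hρ1 : ∀ j ≤ n, 2 * ρ 1 j = ε 1 * (p 0 * q j - p j))
    (hρ2 : ∀ j, 1 ≤ j → j ≤ n → ρ 2 j = ε 1 * ε 2 * (q 1 * ρ 1 j - q j))
    (hρ : ∀ k j, 3 ≤ k → k ≤ n → k - 1 ≤ j → j ≤ n →
      ρ k j = ε (k - 1) * ε k * (m (k - 2) * ρ (k - 1) j - ρ (k - 2) j)) :
    ∀ k j, 1 ≤ k → k ≤ n → k ≤ j → j ≤ n → ρ k (j - 1) < ρ k j := by
  have sq {k : ℕ} (h1 : 1 ≤ k) (h2 : k ≤ n) : ε k * ε k = 1 := by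
    rcases hε k h1 h2 with h | h <;> simp [h]
  have key : ∀ k, k + 1 ≤ n → ρ (k + 1) k = 0 ∧ ρ (k + 1) (k + 1) = 1 ∧
      ∀ j, k ≤ j → j + 2 ≤ n →
        ρ (k + 1) (j + 2) = m (j + 1) * ρ (k + 1) (j + 1) - ε (j + 1) * ε (j + 2) * ρ (k + 1) j := by
    intro k
    induction k using Nat.strong_induction_on with
    | _ k ih =>
    intro hk
    match k with
    | 0 =>
      refine ⟨?_, ?_, fun j _ hj => ?_⟩
      · have h := hρ1 0 (by lia)
        rw [hq0] at h
        linarith [h, show ε 1 * (p 0 * 1 - p 0) = 0 by ring]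
      · have h := hρ1 1 hk
        rw [hp1] at h
        linarith [sq le_rfl hk]
      · obtain ⟨hp, hq⟩ := hrec (j + 2) (by lia) hj
        have h0 := hρ1 j (by lia)
        have h1 := hρ1 (j + 1) (by lia)
        have h2 := hρ1 (j + 2) hj
        simp only [Nat.add_sub_cancel, show j + 2 - 1 = j + 1 by lia] at hp hq
        rw [hp, hq] at h2
        refine mul_left_cancel₀ (two_ne_zero (α := ℤ)) ?_
        linear_combination h2 - m (j + 1) * h1 + ε (j + 1) * ε (j + 2) * h0
    | 1 =>
      obtain ⟨h10, h11, h1⟩ := ih 0 (by lia) (by lia)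
      simp only [zero_add, Nat.reduceAdd] at h10 h11 h1 ⊢
      refine ⟨?_, ?_, fun j hj1 hj => ?_⟩
      · rw [hρ2 1 le_rfl (by lia), h11]
        ring
      · have hq := (hrec 2 le_rfl hk).2
        have h12 := h1 0 le_rfl hk
        simp only [zero_add, Nat.reduceSub] at hq h12
        rw [hρ2 2 (by lia) hk, hq, h12, h10, h11, hq0]
        linear_combination ε 2 * ε 2 * sq le_rfl (by lia : 1 ≤ n) + sq (by lia) hk
      · have hq := (hrec (j + 2) (by lia) hj).2
        simp only [Nat.add_sub_cancel, show j + 2 - 1 = j + 1 by lia] at hq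
        rw [hρ2 (j + 2) (by lia) hj, hρ2 (j + 1) (by lia) (by lia), hρ2 j hj1 (by lia), hq,
          h1 j (by lia) hj]
        ring
    | k + 2 =>
      obtain ⟨ha0, ha1, ha⟩ := ih k (by lia) (by lia)
      obtain ⟨hb0, hb1, hb⟩ := ih (k + 1) (by lia) (by lia)
      have hstep (j : ℕ) (hkj : k + 2 ≤ j) (hj : j ≤ n) : ρ (k + 3) j =
          ε (k + 2) * ε (k + 3) * (m (k + 1) * ρ (k + 2) j - ρ (k + 1) j) :=
        hρ (k + 3) j (by lia) hk hkj hj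
      have ha2 := ha k le_rfl (by lia)
      have ha3 := ha (k + 1) (by lia) hk
      have hb2 := hb (k + 1) le_rfl hk
      simp only [add_assoc, Nat.reduceAdd] at *
      refine ⟨?_, ?_, fun j hkj hj => ?_⟩
      · rw [hstep (k + 2) le_rfl (by lia), hb1, ha2, ha0, ha1]
        ring
      · rw [hstep (k + 3) (by lia) hk, hb2, ha3, ha2, ha0, ha1, hb0, hb1]
        linear_combination ε (k + 3) * ε (k + 3) * sq (by lia : 1 ≤ k + 2) (by lia) +
          sq (by lia : 1 ≤ k + 3) hk
      · rw [hstep (j + 2) (by lia) hj, hstep (j + 1) (by lia) (by lia), hstep j hkj (by lia),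
          ha j (by lia) hj, hb j (by lia) hj]
        ring
  intro k j hk1 hkn hkj hjn
  obtain ⟨k, rfl⟩ := Nat.exists_eq_add_of_le' hk1
  obtain ⟨j, rfl⟩ := Nat.exists_eq_add_of_le' (hk1.trans hkj)
  obtain ⟨h0, h1, hr⟩ := key k hkn
  refine (nonneg_and_lt_succ_of_three_term_recurrence (x := ρ (k + 1)) (m := fun j => m (j + 1))
    (c := fun j => ε (j + 1) * ε (j + 2)) (fun j _ hj => (hm (j + 1) (by lia) (by lia)).2)
    (fun j _ hj => ?_) h0 h1 hr j (by lia) hjn).2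
  rcases hε (j + 1) (by lia) (by lia) with h | h <;>
    rcases hε (j + 2) (by lia) hj with h' | h' <;> simp [h, h']
end

section
/- Given pinch-move data with n ≥ 2 and the associated doubly indexed sequence ρ, for all 2 ≤ k ≤ n one has ρ_{k−1,j} − ρ_{k,j} ≥ ρ_{k−1,j−1} − ρ_{k,j−1} for all k ≤ j ≤ n, and consequently the strict inequality ρ_{k,j} < ρ_{k−1,j} holds for all k − 1 ≤ j ≤ n. -/
/-- A solution of `d (j + 2) = m (j + 1) * d (j + 1) - c j * d j` with `c j = ±1` and `m ≥ 2` that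
starts with `1 ≤ d a ≤ d (a + 1)` is nondecreasing and stays at least `1`. -/
lemma one_le_and_le_succ_of_recurrence {n a : ℕ} {d m c : ℕ → ℤ}
    (hc : ∀ j, a ≤ j → j + 2 ≤ n → c j = 1 ∨ c j = -1)
    (hm : ∀ j, a ≤ j → j + 2 ≤ n → 2 ≤ m (j + 1))
    (hd : ∀ j, a ≤ j → j + 2 ≤ n → d (j + 2) = m (j + 1) * d (j + 1) - c j * d j)
    (h0 : 1 ≤ d a) (h1 : d a ≤ d (a + 1)) :
    ∀ j, a ≤ j → j + 1 ≤ n → 1 ≤ d j ∧ d j ≤ d (j + 1) := by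
  intro j hj
  induction j, hj using Nat.le_induction with
  | base => exact fun _ => ⟨h0, h1⟩
  | succ j hj ih =>
    intro hjn
    obtain ⟨h2, h3⟩ := ih (by omega)
    refine ⟨by omega, ?_⟩
    have h4 := hm j hj hjn
    rw [show j + 1 + 1 = j + 2 from rfl, hd j hj hjn]
    have h5 : 2 * d (j + 1) ≤ m (j + 1) * d (j + 1) :=
      mul_le_mul_of_nonneg_right h4 (by omega)
    rcases hc j hj hjn with h | h <;> rw [h] <;> linarith

/-- If `u` and `v` solve the recurrence `x (j + 2) = m (j + 1) * x (j + 1) - c j * x j`, so does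
any linear combination of them. -/
lemma recurrence_linear_combination {n a b : ℕ} {u v w m c : ℕ → ℤ} {r s : ℤ}
    (hu : ∀ j, a ≤ j → j + 2 ≤ n → u (j + 2) = m (j + 1) * u (j + 1) - c j * u j)
    (hv : ∀ j, a ≤ j → j + 2 ≤ n → v (j + 2) = m (j + 1) * v (j + 1) - c j * v j)
    (hab : a ≤ b) (hw : ∀ j, b ≤ j → j ≤ n → w j = r * u j + s * v j) :
    ∀ j, b ≤ j → j + 2 ≤ n → w (j + 2) = m (j + 1) * w (j + 1) - c j * w j := by
  intro j hj hjn
  rw [hw j hj (by omega), hw (j + 1) (by omega) (by omega), hw (j + 2) (by omega) hjn,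
    hu j (by omega) hjn, hv j (by omega) hjn]
  ring

/-- Given pinch-move data with `n ≥ 2`, for `2 ≤ k ≤ n` the differences
`ρ (k-1) j - ρ k j` are nondecreasing in `j` on `k ≤ j ≤ n`, and consequently
`ρ k j < ρ (k-1) j` for all `k - 1 ≤ j ≤ n`. -/
theorem stmt_13
    (n : ℕ) (hn : 2 ≤ n) (p q ε m : ℕ → ℤ)
    (hq0 : q 0 = 1) (hp0 : 0 ≤ p 0)
    (hq1odd : Odd (q 1)) (hq1 : 3 ≤ q 1)
    (hε : ∀ k, 1 ≤ k → k ≤ n → ε k = 1 ∨ ε k = -1)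
    (hε1 : p 0 = 0 ∨ p 0 = 1 → ε 1 = -1)
    (hm : ∀ k, 1 ≤ k → k ≤ n - 1 → Even (m k) ∧ 2 ≤ m k)
    (hp1 : p 1 = p 0 * q 1 - 2 * ε 1)
    (hrec : ∀ k, 2 ≤ k → k ≤ n →
      p k = m (k - 1) * p (k - 1) - ε (k - 1) * ε k * p (k - 2) ∧
      q k = m (k - 1) * q (k - 1) - ε (k - 1) * ε k * q (k - 2))
    (ρ : ℕ → ℕ → ℤ)
    (hρ1 : ∀ j ≤ n, 2 * ρ 1 j = ε 1 * (p 0 * q j - p j))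
    (hρ2 : ∀ j, 1 ≤ j → j ≤ n → ρ 2 j = ε 1 * ε 2 * (q 1 * ρ 1 j - q j))
    (hρ : ∀ k j, 3 ≤ k → k ≤ n → k - 1 ≤ j → j ≤ n →
      ρ k j = ε (k - 1) * ε k * (m (k - 2) * ρ (k - 1) j - ρ (k - 2) j)) :
    ∀ k, 2 ≤ k → k ≤ n →
      (∀ j, k ≤ j → j ≤ n →
        ρ (k - 1) (j - 1) - ρ k (j - 1) ≤ ρ (k - 1) j - ρ k j) ∧
      (∀ j, k - 1 ≤ j → j ≤ n → ρ k j < ρ (k - 1) j) := by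
  set c : ℕ → ℤ := fun j => ε (j + 1) * ε (j + 2) with hc
  have c_sign : ∀ j, j + 2 ≤ n → c j = 1 ∨ c j = -1 := by
    intro j hj
    rcases hε (j + 1) (by omega) (by omega) with h | h <;>
      rcases hε (j + 2) (by omega) hj with h' | h' <;> simp [hc, h, h']
  have c_sq : ∀ j, j + 2 ≤ n → c j * c j = 1 := by
    intro j hj
    rcases c_sign j hj with h | h <;> rw [h] <;> norm_num
  have p_rec : ∀ j, 0 ≤ j → j + 2 ≤ n → p (j + 2) = m (j + 1) * p (j + 1) - c j * p j :=
    fun j _ hj => (hrec (j + 2) (by omega) hj).1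
  have q_rec : ∀ j, 0 ≤ j → j + 2 ≤ n → q (j + 2) = m (j + 1) * q (j + 1) - c j * q j :=
    fun j _ hj => (hrec (j + 2) (by omega) hj).2
  have ε_sq : ε 1 * ε 1 = 1 := by
    rcases hε 1 le_rfl (by omega) with h | h <;> rw [h] <;> norm_num
  -- row `k + 1` of `ρ` is the solution of the recurrence with value `0` at `k` and `1` at `k + 1`
  have row : ∀ k, k + 1 ≤ n → ρ (k + 1) k = 0 ∧ ρ (k + 1) (k + 1) = 1 ∧
      ∀ j, k ≤ j → j + 2 ≤ n →
        ρ (k + 1) (j + 2) = m (j + 1) * ρ (k + 1) (j + 1) - c j * ρ (k + 1) j := by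
    intro k
    induction k using Nat.strong_induction_on with
    | _ k ih =>
      intro hk
      match k, ih, hk with
      | 0, _, _ =>
        have h0 := hρ1 0 (by omega)
        have h1 := hρ1 1 (by omega)
        rw [hq0] at h0
        rw [hp1] at h1
        refine ⟨by linarith, by linarith, fun j hj hjn => ?_⟩
        have h := recurrence_linear_combination (w := fun j => 2 * ρ 1 j) (r := ε 1 * p 0)
          (s := -ε 1) q_rec p_rec le_rfl (fun j _ hj => by rw [hρ1 j hj]; ring) j hj hjn
        simp only [Nat.zero_add]
        linarith
      | 1, ih, hk =>
        obtain ⟨h0, h1, hr⟩ := ih 0 (by omega) (by omega)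
        simp only [Nat.zero_add] at h0 h1 hr
        have hw : ∀ j, 1 ≤ j → j ≤ n → ρ 2 j = (c 0 * q 1) * ρ 1 j + (-c 0) * q j := by
          intro j h h'
          rw [hρ2 j h h']
          ring
        have hr2 := hr 0 le_rfl hk
        have hq2 := q_rec 0 le_rfl hk
        simp only [Nat.zero_add] at hr2 hq2
        refine ⟨?_, ?_, recurrence_linear_combination hr q_rec (by omega) hw⟩
        · rw [hw 1 le_rfl (by omega), h1]
          ring
        · rw [hw 2 (by omega) hk, hr2, hq2, h0, h1, hq0]
          linear_combination c_sq 0 hk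
      | k + 2, ih, hk =>
        obtain ⟨a0, a1, ar⟩ := ih k (by omega) (by omega)
        obtain ⟨b0, b1, br⟩ := ih (k + 1) (by omega) (by omega)
        have hw : ∀ j, k + 2 ≤ j → j ≤ n → ρ (k + 3) j =
            (c (k + 1) * m (k + 1)) * ρ (k + 2) j + (-c (k + 1)) * ρ (k + 1) j := by
          intro j h h'
          have := hρ (k + 3) j (by omega) hk (by omega) h'
          rw [this]
          simp only [hc, show k + 3 - 1 = k + 2 from rfl, show k + 3 - 2 = k + 1 from rfl,
            show k + 1 + 1 = k + 2 from rfl, show k + 1 + 2 = k + 3 from rfl]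
          ring
        have a2 := ar k le_rfl (by omega)
        have a3 := ar (k + 1) (by omega) (by omega)
        have b3 := br (k + 1) le_rfl (by omega)
        simp only [Nat.add_assoc, Nat.reduceAdd] at a0 a1 a2 a3 b0 b1 b3 hk ⊢
        refine ⟨?_, ?_, ?_⟩
        · rw [hw (k + 2) le_rfl (by omega), b1, a2, a1, a0]
          ring
        · rw [hw (k + 3) (by omega) hk, b3, a3, a2, b1, b0, a1, a0]
          linear_combination c_sq (k + 1) hk
        · exact recurrence_linear_combination br
            (fun j hj => ar j (by omega)) (by omega) hw
  intro k hk hkn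
  obtain ⟨k, rfl⟩ := Nat.exists_eq_add_of_le' hk
  obtain ⟨a0, a1, ar⟩ := row k (by omega)
  obtain ⟨b0, b1, br⟩ := row (k + 1) hkn
  have a2 := ar k le_rfl hkn
  have hm1 := (hm (k + 1) (by omega) (by omega)).2
  have mono := one_le_and_le_succ_of_recurrence (n := n) (a := k + 1)
    (d := fun j => ρ (k + 1) j - ρ (k + 2) j) (m := m) (c := c)
    (fun j _ h => c_sign j h) (fun j _ h => (hm (j + 1) (by omega) (by omega)).2)
    (fun j hj h => by
      have h1 := ar j (by omega) h
      have h2 := br j hj h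
      linear_combination h1 - h2)
    (by simp only [Nat.add_assoc, Nat.reduceAdd] at *; omega)
    (by
      simp only [Nat.add_assoc, Nat.reduceAdd] at *
      rw [a2, a1, a0, b0, b1]
      linarith)
  refine ⟨fun j hj hjn => ?_, fun j hj hjn => ?_⟩
  · obtain ⟨i, rfl⟩ := Nat.exists_eq_add_of_le' (show 1 ≤ j by omega)
    exact (mono i (by omega) hjn).2
  · change ρ (k + 2) j < ρ (k + 1) j
    rcases Nat.lt_or_ge j n with h | h
    · have := (mono j (by omega) h).1
      linarith
    · obtain ⟨i, rfl⟩ := Nat.exists_eq_add_of_le' (show 1 ≤ j by omega)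
      have := mono i (by omega) hjn
      linarith [this.1, this.2]
end

section
/- Given pinch-move data with n ≥ 2 and the associated doubly indexed sequence ρ, one has 2·ρ_{1,j} < q_j for all 1 ≤ j ≤ n. -/
/-- A sequence with `0 < d 0 ≤ d 1` and `d k = a k * d (k - 1) - s k * d (k - 2)`, where `2 ≤ a k`
and `s k = ±1`, is positive and nondecreasing. -/
theorem pos_and_le_succ_of_two_term_recurrence (n : ℕ) (d a s : ℕ → ℤ)
    (h0 : 0 < d 0) (h01 : d 0 ≤ d 1)
    (ha : ∀ k, k + 2 ≤ n → 2 ≤ a k) (hs : ∀ k, k + 2 ≤ n → s k = 1 ∨ s k = -1)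
    (hd : ∀ k, k + 2 ≤ n → d (k + 2) = a k * d (k + 1) - s k * d k) (j : ℕ) (hj : j + 1 ≤ n) :
    0 < d j ∧ d j ≤ d (j + 1) := by
  induction j with
  | zero => exact ⟨h0, h01⟩
  | succ k ih =>
    obtain ⟨hpos, hle⟩ := ih (by lia)
    refine ⟨by lia, ?_⟩
    have hmul : 2 * d (k + 1) ≤ a k * d (k + 1) :=
      mul_le_mul_of_nonneg_right (ha k hj) (by lia)
    rw [hd k hj]
    rcases hs k hj with h | h <;> rw [h] <;> lia

/-- Given pinch-move data with `n ≥ 2`, one has `2 * ρ 1 j < q j` for `1 ≤ j ≤ n`. -/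
theorem stmt_14
    (n : ℕ) (hn : 2 ≤ n) (p q ε m : ℕ → ℤ)
    (hq0 : q 0 = 1) (hp0 : 0 ≤ p 0)
    (hq1odd : Odd (q 1)) (hq1 : 3 ≤ q 1)
    (hε : ∀ k, 1 ≤ k → k ≤ n → ε k = 1 ∨ ε k = -1)
    (hε1 : p 0 = 0 ∨ p 0 = 1 → ε 1 = -1)
    (hm : ∀ k, 1 ≤ k → k ≤ n - 1 → Even (m k) ∧ 2 ≤ m k)
    (hp1 : p 1 = p 0 * q 1 - 2 * ε 1)
    (hrec : ∀ k, 2 ≤ k → k ≤ n →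
      p k = m (k - 1) * p (k - 1) - ε (k - 1) * ε k * p (k - 2) ∧
      q k = m (k - 1) * q (k - 1) - ε (k - 1) * ε k * q (k - 2))
    (ρ : ℕ → ℕ → ℤ)
    (hρ1 : ∀ j ≤ n, 2 * ρ 1 j = ε 1 * (p 0 * q j - p j))
    (hρ2 : ∀ j, 1 ≤ j → j ≤ n → ρ 2 j = ε 1 * ε 2 * (q 1 * ρ 1 j - q j))
    (hρ : ∀ k j, 3 ≤ k → k ≤ n → k - 1 ≤ j → j ≤ n →
      ρ k j = ε (k - 1) * ε k * (m (k - 2) * ρ (k - 1) j - ρ (k - 2) j)) :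
    ∀ j, 1 ≤ j → j ≤ n → 2 * ρ 1 j < q j := by
  intro j hj1 hjn
  have hsq : ε 1 * ε 1 = 1 := by
    rcases hε 1 le_rfl (by lia) with h | h <;> simp [h]
  have hmono := pos_and_le_succ_of_two_term_recurrence n
    (fun k => q k - ε 1 * (p 0 * q k - p k)) (fun k => m (k + 1))
    (fun k => ε (k + 1) * ε (k + 2))
    (by simp [hq0]) (by simp only [hp1, hq0]; linear_combination hq1 + 2 * hsq)
    (fun k hk => (hm (k + 1) (by lia) (by lia)).2)
    (fun k hk => by
      rcases hε (k + 1) (by lia) (by lia) with h | h <;>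
      rcases hε (k + 2) (by lia) hk with h' | h' <;> simp [h, h'])
    (fun k hk => by
      obtain ⟨hp, hq⟩ := hrec (k + 2) (by lia) hk
      simp only [Nat.add_sub_cancel, show k + 2 - 1 = k + 1 from rfl] at hp hq
      simp only [hp, hq]
      ring)
  obtain ⟨i, rfl⟩ : ∃ i, j = i + 1 := ⟨j - 1, by lia⟩
  obtain ⟨hpos, hle⟩ := hmono i hjn
  rw [hρ1 (i + 1) hjn]
  exact sub_pos.mp (hpos.trans_le hle)
end

section
/- Given pinch-move data, the integer p₀ − p_n·q_n is even and satisfies p₀ − p_n·q_n ≡ 2n (mod 4); equivalently, (p₀ − p_n·q_n)/2 is an integer congruent to n modulo 2. -/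
/-- One step of the recursion with an even coefficient and a sign leaves the product `p * q`
two indices earlier unchanged mod 4, provided the determinant is even. -/
lemma four_dvd_mul_sub_mul_of_even {p q r s m e : ℤ} (hm : Even m) (he : e = 1 ∨ e = -1)
    (hdet : (2 : ℤ) ∣ p * s - r * q) :
    (4 : ℤ) ∣ (m * p - e * r) * (m * q - e * s) - r * s := by
  obtain ⟨a, rfl⟩ := hm
  obtain ⟨d, hd⟩ := hdet
  have he2 : e * e = 1 := by rcases he with rfl | rfl <;> norm_num
  refine ⟨a ^ 2 * p * q - a * e * (d + r * q), ?_⟩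
  linear_combination (-2 * a * e) * hd + r * s * he2

lemma two_dvd_det_step {p q r s m e : ℤ} (hdet : (2 : ℤ) ∣ p * s - r * q) :
    (2 : ℤ) ∣ (m * p - e * r) * q - p * (m * q - e * s) := by
  obtain ⟨d, hd⟩ := hdet
  exact ⟨e * d, by linear_combination e * hd⟩

/-- Given pinch-move data, `p 0 - p n * q n` is even and congruent to `2n` mod 4;
equivalently `(p 0 - p n * q n)/2` is an integer congruent to `n` mod 2. -/
theorem stmt_16
    (n : ℕ) (hn : 1 ≤ n) (p q ε m : ℕ → ℤ)
    (hq0 : q 0 = 1) (hp0 : 0 ≤ p 0)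
    (hq1odd : Odd (q 1)) (hq1 : 3 ≤ q 1)
    (hε : ∀ k, 1 ≤ k → k ≤ n → ε k = 1 ∨ ε k = -1)
    (hε1 : p 0 = 0 ∨ p 0 = 1 → ε 1 = -1)
    (hm : ∀ k, 1 ≤ k → k ≤ n - 1 → Even (m k) ∧ 2 ≤ m k)
    (hp1 : p 1 = p 0 * q 1 - 2 * ε 1)
    (hrec : ∀ k, 2 ≤ k → k ≤ n →
      p k = m (k - 1) * p (k - 1) - ε (k - 1) * ε k * p (k - 2) ∧
      q k = m (k - 1) * q (k - 1) - ε (k - 1) * ε k * q (k - 2)) :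
    Even (p 0 - p n * q n) ∧
    Int.ModEq 4 (p 0 - p n * q n) (2 * (n : ℤ)) ∧
    ∃ d : ℤ, 2 * d = p 0 - p n * q n ∧ Int.ModEq 2 d (n : ℤ) := by
  have base : (4 : ℤ) ∣ p 0 - p 1 * q 1 - 2 := by
    obtain ⟨a, ha⟩ := hq1odd
    rw [hp1, ha]
    rcases hε 1 le_rfl hn with h | h <;> rw [h]
    · exact ⟨-p 0 * (a ^ 2 + a) + a, by ring⟩
    · exact ⟨-p 0 * (a ^ 2 + a) - a - 1, by ring⟩
  have invariant : ∀ k : ℕ, k + 1 ≤ n →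
      (4 : ℤ) ∣ p 0 - p k * q k - 2 * k ∧
      (4 : ℤ) ∣ p 0 - p (k + 1) * q (k + 1) - 2 * (k + 1) ∧
      (2 : ℤ) ∣ p (k + 1) * q k - p k * q (k + 1) := by
    intro k
    induction k with
    | zero =>
      intro _
      refine ⟨by simp [hq0], by simpa using base, -ε 1, ?_⟩
      simp only [zero_add, hq0, hp1]
      ring
    | succ k ih =>
      intro hk
      obtain ⟨hprev, hcur, hdet⟩ := ih (by omega)
      obtain ⟨hp, hq⟩ := hrec (k + 2) (by omega) hk
      rw [show k + 2 - 1 = k + 1 by omega, Nat.add_sub_cancel] at hp hq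
      have he : ε (k + 1) * ε (k + 2) = 1 ∨ ε (k + 1) * ε (k + 2) = -1 := by
        rcases hε (k + 1) (by omega) (by omega) with h | h <;>
          rcases hε (k + 2) (by omega) hk with h' | h' <;> simp [h, h']
      have hstep := four_dvd_mul_sub_mul_of_even (hm (k + 1) (by omega) (by omega)).1 he hdet
      have hdet' := two_dvd_det_step (m := m (k + 1)) (e := ε (k + 1) * ε (k + 2)) hdet
      rw [← hp, ← hq] at hstep hdet'
      refine ⟨by exact_mod_cast hcur, ?_, hdet'⟩
      push_cast
      rw [show k + 1 + 1 = k + 2 from rfl]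
      omega
  obtain ⟨k, rfl⟩ : ∃ k, n = k + 1 := ⟨n - 1, by omega⟩
  obtain ⟨d, hd⟩ := (invariant k le_rfl).2.1
  push_cast
  refine ⟨⟨2 * d + (k + 1), by linarith⟩, ?_, 2 * d + (k + 1), by linarith, ?_⟩
  · exact (Int.modEq_iff_dvd.mpr ⟨d, hd⟩).symm
  · exact (Int.modEq_iff_dvd.mpr ⟨d, by ring⟩).symm
end

section
/- Given pinch-move data, the sequences are strictly increasing: q_{k−1} < q_k for all 1 ≤ k ≤ n, and p_{k−1} < p_k for all 1 ≤ k ≤ n. -/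
/-- One step of a recursion `c = m * b - s * a` with `2 ≤ m` and `s ≤ 1` preserves growth. -/
theorem lt_mul_sub_mul_of_lt {a b m s : ℤ} (ha : 0 ≤ a) (hab : a < b) (hm : 2 ≤ m)
    (hs : s ≤ 1) : b < m * b - s * a := by
  nlinarith [mul_nonneg (sub_nonneg.2 hm) (ha.trans hab.le), mul_nonneg (sub_nonneg.2 hs) ha]

/-- Given pinch-move data, the sequences `q` and `p` are strictly increasing:
`q (k-1) < q k` and `p (k-1) < p k` for all `1 ≤ k ≤ n`. -/
theorem stmt_18
    (n : ℕ) (hn : 1 ≤ n) (p q ε m : ℕ → ℤ)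
    (hq0 : q 0 = 1) (hp0 : 0 ≤ p 0)
    (hq1odd : Odd (q 1)) (hq1 : 3 ≤ q 1)
    (hε : ∀ k, 1 ≤ k → k ≤ n → ε k = 1 ∨ ε k = -1)
    (hε1 : p 0 = 0 ∨ p 0 = 1 → ε 1 = -1)
    (hm : ∀ k, 1 ≤ k → k ≤ n - 1 → Even (m k) ∧ 2 ≤ m k)
    (hp1 : p 1 = p 0 * q 1 - 2 * ε 1)
    (hrec : ∀ k, 2 ≤ k → k ≤ n →
      p k = m (k - 1) * p (k - 1) - ε (k - 1) * ε k * p (k - 2) ∧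
      q k = m (k - 1) * q (k - 1) - ε (k - 1) * ε k * q (k - 2)) :
    ∀ k, 1 ≤ k → k ≤ n → q (k - 1) < q k ∧ p (k - 1) < p k := by
  have base : p 0 < p 1 := by
    rw [hp1]
    rcases (by lia : p 0 = 0 ∨ p 0 = 1 ∨ 2 ≤ p 0) with h | h | h
    · rw [hε1 (Or.inl h), h]
      norm_num
    · rw [hε1 (Or.inr h), h]
      linarith
    · rcases hε 1 le_rfl hn with h' | h' <;> rw [h'] <;> nlinarith
  have key : ∀ k, k + 1 ≤ n →
      (0 ≤ q k ∧ q k < q (k + 1)) ∧ (0 ≤ p k ∧ p k < p (k + 1)) := by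
    intro k
    induction k with
    | zero => exact fun _ => ⟨⟨by lia, by rw [zero_add]; lia⟩, hp0, base⟩
    | succ k ih =>
      intro hk
      obtain ⟨⟨hq, hqlt⟩, hp, hplt⟩ := ih (by lia)
      obtain ⟨hprec, hqrec⟩ : p (k + 2) = m (k + 1) * p (k + 1) - ε (k + 1) * ε (k + 2) * p k ∧
          q (k + 2) = m (k + 1) * q (k + 1) - ε (k + 1) * ε (k + 2) * q k :=
        hrec (k + 2) (by lia) hk
      have hm2 : 2 ≤ m (k + 1) := (hm (k + 1) (by lia) (by lia)).2
      have hs : ε (k + 1) * ε (k + 2) ≤ 1 := by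
        rcases hε (k + 1) (by lia) (by lia) with h | h <;>
          rcases hε (k + 2) (by lia) hk with h' | h' <;> rw [h, h'] <;> norm_num
      refine ⟨⟨hq.trans hqlt.le, ?_⟩, hp.trans hplt.le, ?_⟩
      · exact hqrec ▸ lt_mul_sub_mul_of_lt hq hqlt hm2 hs
      · exact hprec ▸ lt_mul_sub_mul_of_lt hp hplt hm2 hs
  intro k hk hkn
  obtain ⟨j, rfl⟩ := Nat.exists_eq_add_of_le' hk
  exact ⟨(key j hkn).1.2, (key j hkn).2.2⟩
end
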